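/- Fix T > 0, a tolerance D > 0 with D < π, a unit vector n⋆ ∈ ℝ³, and boundary data n₀, n_T ∈ ℝ³ with ‖n₀‖ = ‖n_T‖ = 1 and v₀, v_T ∈ ℝ³ with ⟨n₀, v₀⟩ = ⟨n_T, v_T⟩ = 0. Call a curve n : [0,T] → ℝ³ admissible if it is twice continuously differentiable, ‖n(t)‖ = 1 for all t ∈ [0,T], and n(0) = n₀, n'(0) = v₀, n(T) = n_T, n'(T) = v_T. For τ > 0 and N ∈ ℕ, N ≥ 1, consider the action J_{τ,D,N}[n] = ∫₀ᵀ ( ½ ‖n''(t) + ‖n'(t)‖² n(t)‖² + τ / (1 + (θ(n(t))/D)^{2N}) ) dt, where θ(x) = arccos⟨x, n⋆⟩. Assume the problem is feasible: there exists an admissible curve γ with θ(γ(t)) ≥ D for all t ∈ [0,T]. Then for every r ∈ (0, D) there exist τ⋆ > 0 and N⋆ ∈ ℕ such that for all τ ≥ τ⋆ and all N ≥ N⋆, every admissible curve n minimising J_{τ,D,N} over the admissible class (i.e., J_{τ,D,N}[n] ≤ J_{τ,D,N}[m] for all admissible m) satisfies θ(n(t)) ≥ r for all t ∈ [0,T].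 -/

import Mathlib

open RealInnerProductSpace

noncomputable abbrev E3 : Type := EuclideanSpace ℝ (Fin 3)

/-- A curve `n : ℝ → ℝ³` is admissible for the boundary-value problem on `[0,T]`:
twice continuously differentiable, unit norm on `[0,T]`, and matching the
prescribed boundary positions and velocities. -/
def Admissible (T : ℝ) (n₀ nT v₀ vT : E3) (n : ℝ → E3) : Prop :=
  ContDiff ℝ 2 n ∧ (∀ t ∈ Set.Icc (0:ℝ) T, ‖n t‖ = 1) ∧
    n 0 = n₀ ∧ deriv n 0 = v₀ ∧ n T = nT ∧ deriv n T = vT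

/-- The geodesic distance on the sphere from `x` to the unit vector `m`. -/
noncomputable def sphereDist (x m : E3) : ℝ := Real.arccos ⟪x, m⟫

/-- The action `J_{τ,D,N}[n]`: integral of half the squared covariant
acceleration plus the obstacle potential `τ/(1+(θ(n(t))/D)^{2N})`. -/
noncomputable def actionJ (T τ D : ℝ) (N : ℕ) (nstar : E3) (n : ℝ → E3) : ℝ :=
  ∫ t in (0:ℝ)..T,
    ((1:ℝ)/2 * ‖deriv (deriv n) t + (‖deriv n t‖ ^ 2) • n t‖ ^ 2
      + τ / (1 + (sphereDist (n t) nstar / D) ^ (2 * N)))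


section Periodic

/-- The averages over `[0, v]` of a nonnegative continuous periodic function which is positive at
the origin are bounded away from zero. -/
theorem exists_pos_le_integral_comp_mul {g : ℝ → ℝ} {P : ℝ} (hP : 0 < P) (hg : Continuous g)
    (hper : Function.Periodic g P) (hnonneg : ∀ x, 0 ≤ g x) (hpos : 0 < g 0) :
    ∃ c, 0 < c ∧ ∀ v, 0 ≤ v → c ≤ ∫ s in (0:ℝ)..1, g (v * s) := by
  have hcont : Continuous fun v => ∫ s in (0:ℝ)..1, g (v * s) := by
    apply intervalIntegral.continuous_parametric_intervalIntegral_of_continuous'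
    simp only [Function.uncurry_def]
    fun_prop
  have hposv : ∀ v, 0 < ∫ s in (0:ℝ)..1, g (v * s) := fun v =>
    intervalIntegral.integral_pos zero_lt_one (by fun_prop) (fun s _ => hnonneg _)
      ⟨0, by simp, by simpa using hpos⟩
  have hposP : 0 < ∫ s in (0:ℝ)..P, g s :=
    intervalIntegral.integral_pos hP (by fun_prop) (fun s _ => hnonneg _)
      ⟨0, by simp [hP.le], hpos⟩
  obtain ⟨v₀, -, hv₀⟩ := (isCompact_Icc (a := (0:ℝ)) (b := P)).exists_isMinOn
    ⟨0, by simp [hP.le]⟩ hcont.continuousOn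
  refine ⟨min (∫ s in (0:ℝ)..1, g (v₀ * s)) ((∫ s in (0:ℝ)..P, g s) / (2 * P)),
    lt_min (hposv _) (by positivity), fun v hv => ?_⟩
  rcases le_or_gt v P with h | h
  · exact (min_le_left _ _).trans (hv₀ ⟨hv, h⟩)
  · refine (min_le_right _ _).trans ?_
    have hv' : 0 < v := hP.trans h
    rw [intervalIntegral.integral_comp_mul_left _ hv'.ne']
    simp only [mul_zero, mul_one, smul_eq_mul]
    have h1 : (⌊v / P⌋ : ℝ) * P ≤ v := (le_div_iff₀ hP).1 (Int.floor_le _)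
    have h2 : v < (⌊v / P⌋ + 1 : ℝ) * P := (div_lt_iff₀ hP).1 (Int.lt_floor_add_one _)
    have h3 : (1:ℝ) ≤ ⌊v / P⌋ := by
      exact_mod_cast Int.le_floor.2 (by rw [Int.cast_one, le_div_iff₀ hP]; linarith)
    have h4 : (⌊v / P⌋ : ℝ) * (∫ s in (0:ℝ)..P, g s) = ∫ s in (0:ℝ)..(⌊v / P⌋ : ℝ) * P, g s := by
      have := hper.intervalIntegral_add_zsmul_eq ⌊v / P⌋ 0 
        (fun t₁ t₂ => hg.intervalIntegrable t₁ t₂)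
      simpa using this.symm
    have h5 : ∫ s in (0:ℝ)..(⌊v / P⌋ : ℝ) * P, g s ≤ ∫ s in (0:ℝ)..v, g s :=
      intervalIntegral.integral_mono_interval le_rfl (by positivity) h1
        (Filter.Eventually.of_forall hnonneg) (hg.intervalIntegrable _ _)
    rw [← div_eq_inv_mul, div_le_div_iff₀ (by positivity) hv']
    nlinarith [mul_nonneg hposP.le (sub_nonneg.2 h3)]

end Periodic

section SphereGeometry

variable {E : Type*} [NormedAddCommGroup E] [InnerProductSpace ℝ E]

/-- The covariant acceleration of a curve on the unit sphere. -/
noncomputable def covAccel (n : ℝ → E) (t : ℝ) : E :=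
  deriv (deriv n) t + (‖deriv n t‖ ^ 2) • n t

theorem ContDiff.hasDerivAt_deriv_two {n : ℝ → E} (hn : ContDiff ℝ 2 n) (t : ℝ) :
    HasDerivAt n (deriv n t) t ∧ HasDerivAt (deriv n) (deriv (deriv n) t) t ∧
      Continuous (deriv n) ∧ Continuous (deriv (deriv n)) := by
  have h1 : ContDiff ℝ 1 (deriv n) := (contDiff_succ_iff_deriv (n := 1)).1 hn |>.2.2
  exact ⟨(hn.differentiable (by norm_num) t).hasDerivAt,
    (h1.differentiable (by norm_num) t).hasDerivAt, h1.continuous,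
    h1.continuous_deriv (by norm_num)⟩

theorem ContDiff.continuous_covAccel {n : ℝ → E} (hn : ContDiff ℝ 2 n) :
    Continuous (covAccel n) := by
  obtain ⟨-, -, h1, h2⟩ := hn.hasDerivAt_deriv_two 0
  have := hn.continuous
  unfold covAccel
  fun_prop

/-- The velocity of a curve on the sphere is tangent to it. -/
theorem inner_deriv_eq_zero {n : ℝ → E} (hn : ContDiff ℝ 2 n) {a b : ℝ} (hab : a < b)
    (hunit : ∀ t ∈ Set.Icc a b, ‖n t‖ = 1) : ∀ t ∈ Set.Icc a b, ⟪n t, deriv n t⟫ = 0 := by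
  have hcont : Continuous fun t => ⟪n t, deriv n t⟫ := by
    have := (hn.hasDerivAt_deriv_two 0).2.2.1
    have := hn.continuous
    fun_prop
  have hopen : Set.Ioo a b ⊆ {t | ⟪n t, deriv n t⟫ = 0} := by
    intro t ht
    have hd := (hn.hasDerivAt_deriv_two t).1
    have h1 : HasDerivAt (fun t => ⟪n t, n t⟫) (⟪n t, deriv n t⟫ + ⟪deriv n t, n t⟫) t :=
      hd.inner ℝ hd
    have h2 : (fun t => ⟪n t, n t⟫) =ᶠ[nhds t] fun _ => (1:ℝ) := by
      filter_upwards [Icc_mem_nhds ht.1 ht.2] with s hs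
      rw [real_inner_self_eq_norm_sq, hunit s hs, one_pow]
    have h3 := h1.deriv
    rw [h2.deriv_eq, deriv_const, real_inner_comm] at h3
    rw [Set.mem_ofPred_eq, real_inner_comm]
    linarith
  have hclosed : IsClosed {t | ⟪n t, deriv n t⟫ = 0} := isClosed_eq hcont continuous_const
  have := closure_minimal hopen hclosed
  rwa [closure_Ioo hab.ne] at this

/-- If the covariant acceleration of a curve on the sphere is small in `L²`, the distance to the
starting point is almost that of the great circle with the same initial velocity. -/
theorem norm_sub_le_of_integral_covAccel_sq_le {y : ℝ → E} (hy : ContDiff ℝ 2 y)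
    (hunit : ∀ s ∈ Set.Icc (0:ℝ) 1, ‖y s‖ = 1) {ε : ℝ} (hε : 0 < ε)
    (hint : ∫ s in (0:ℝ)..1, ‖covAccel y s‖ ^ 2 ≤ ε ^ 2) {s : ℝ} (hs : s ∈ Set.Icc (0:ℝ) 1) :
    ‖y s - y 0‖ ≤ 2 * √ε + √(2 - 2 * Real.cos (‖deriv y 0‖ * s)) := by
  set v := ‖deriv y 0‖ with hv
  set p := y 0 with hp
  obtain ⟨e, hve, hee⟩ : ∃ e : E, deriv y 0 = v • e ∧ (v = 0 ∨ ‖e‖ = 1) := by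
    rcases eq_or_ne v 0 with h | h
    · exact ⟨0, by simpa [hv] using h, Or.inl h⟩
    · exact ⟨v⁻¹ • deriv y 0, by rw [smul_inv_smul₀ h], Or.inr (by
        rw [norm_smul, norm_inv, ← hv, Real.norm_of_nonneg (norm_nonneg _), inv_mul_cancel₀ h])⟩
  have htang := inner_deriv_eq_zero hy zero_lt_one hunit
  have hpp : ⟪p, p⟫ = (1:ℝ) := by
    rw [real_inner_self_eq_norm_sq, hunit 0 (by simp), one_pow]
  have hpe : v = 0 ∨ (⟪e, e⟫ = (1:ℝ) ∧ ⟪p, e⟫ = (0:ℝ) ∧ ⟪e, p⟫ = (0:ℝ)) := by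
    rcases eq_or_ne v 0 with h | h
    · exact Or.inl h
    · have h0 := htang 0 (by simp)
      rw [hve, inner_smul_right] at h0
      replace h0 := (mul_eq_zero.1 h0).resolve_left h
      refine Or.inr ⟨?_, h0, by rw [real_inner_comm, h0]⟩
      rw [real_inner_self_eq_norm_sq, hee.resolve_left h, one_pow]
  set c : ℝ → E := fun s => Real.cos (v * s) • p + Real.sin (v * s) • e with hc
  have hcnorm : ∀ s, ‖c s‖ = 1 := by
    intro s
    rw [← sq_eq_sq₀ (norm_nonneg _) zero_le_one, ← real_inner_self_eq_norm_sq]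
    simp only [hc, inner_add_left, inner_add_right, inner_smul_left, inner_smul_right,
      conj_trivial, hpp]
    rcases hpe with h | ⟨h1, h2, h3⟩
    · simp [h]
    · rw [h1, h2, h3]
      nlinarith [Real.sin_sq_add_cos_sq (v * s)]
  have hcderiv : ∀ s, HasDerivAt c
      ((-(v * Real.sin (v * s))) • p + (v * Real.cos (v * s)) • e) s := by
    intro s
    have h0 : HasDerivAt (fun s => v * s) v s := by simpa using (hasDerivAt_id s).const_mul v
    refine ((h0.cos.smul_const p).add (h0.sin.smul_const e)).congr_deriv ?_
    rw [neg_mul, mul_comm (Real.sin _), mul_comm (Real.cos _)]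
  obtain ⟨-, -, hcy', hcy''⟩ := hy.hasDerivAt_deriv_two 0
  have hcacc := hy.continuous_covAccel
  have haccint : ∀ s ∈ Set.Icc (0:ℝ) 1, ∫ u in (0:ℝ)..s, 2 * ‖covAccel y u‖ ≤ 2 * ε := by
    intro s hs
    calc ∫ u in (0:ℝ)..s, 2 * ‖covAccel y u‖
        ≤ ∫ u in (0:ℝ)..1, 2 * ‖covAccel y u‖ :=
          intervalIntegral.integral_mono_interval le_rfl hs.1 hs.2
            (Filter.Eventually.of_forall fun u => by positivity)
            (Continuous.intervalIntegrable (by fun_prop) _ _)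
      _ ≤ ∫ u in (0:ℝ)..1, (ε⁻¹ * ‖covAccel y u‖ ^ 2 + ε) := by
          apply intervalIntegral.integral_mono_on zero_le_one
            (Continuous.intervalIntegrable (by fun_prop) _ _)
            (Continuous.intervalIntegrable (by fun_prop) _ _)
          intro u _
          have : ε⁻¹ * ‖covAccel y u‖ ^ 2 + ε - 2 * ‖covAccel y u‖
              = ε⁻¹ * (‖covAccel y u‖ - ε) ^ 2 := by field_simp; ring
          have : 0 ≤ ε⁻¹ * (‖covAccel y u‖ - ε) ^ 2 := by positivity
          linarith
      _ = ε⁻¹ * (∫ u in (0:ℝ)..1, ‖covAccel y u‖ ^ 2) + ε := by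
          rw [intervalIntegral.integral_add (Continuous.intervalIntegrable (by fun_prop) _ _)
            (by simp), intervalIntegral.integral_const_mul]
          simp
      _ ≤ ε⁻¹ * ε ^ 2 + ε := by gcongr
      _ = 2 * ε := by field_simp; ring
  -- the angular momentum of `y` is almost constant
  have hmom : ∀ x z : E, ‖x‖ = 1 → ‖z‖ = 1 → ∀ s ∈ Set.Icc (0:ℝ) 1,
      ⟪p, x⟫ * ⟪deriv y 0, z⟫ - ⟪deriv y 0, x⟫ * ⟪p, z⟫ - 2 * ε ≤
        ⟪y s, x⟫ * ⟪deriv y s, z⟫ - ⟪deriv y s, x⟫ * ⟪y s, z⟫ := by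
    intro x z hx hz s hs
    have hd : ∀ u, HasDerivAt
        (fun s => ⟪y s, x⟫ * ⟪deriv y s, z⟫ - ⟪deriv y s, x⟫ * ⟪y s, z⟫)
        (⟪y u, x⟫ * ⟪covAccel y u, z⟫ - ⟪covAccel y u, x⟫ * ⟪y u, z⟫) u := by
      intro u
      obtain ⟨h1, h2, -, -⟩ := hy.hasDerivAt_deriv_two u
      have hi : ∀ {f : ℝ → E} {f' : E} (w : E), HasDerivAt f f' u →
          HasDerivAt (fun s => ⟪f s, w⟫) ⟪f', w⟫ u := fun w hf => by
        simpa using hf.inner ℝ (hasDerivAt_const u w)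
      refine (((hi x h1).mul (hi z h2)).sub ((hi x h2).mul (hi z h1))).congr_deriv ?_
      simp only [covAccel, inner_add_left, inner_smul_left, conj_trivial]
      ring
    have hcy := hy.continuous
    have hftc := intervalIntegral.integral_eq_sub_of_hasDerivAt (a := 0) (b := s)
      (fun u _ => hd u) (Continuous.intervalIntegrable (by fun_prop) _ _)
    have hbound := intervalIntegral.norm_integral_le_of_norm_le (a := 0) (b := s) hs.1
      (f := fun u => ⟪y u, x⟫ * ⟪covAccel y u, z⟫ - ⟪covAccel y u, x⟫ * ⟪y u, z⟫)
      (g := fun u => 2 * ‖covAccel y u‖) (μ := MeasureTheory.volume)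
      (Filter.Eventually.of_forall fun u hu => by
        have hyu := hunit u ⟨hu.1.le, hu.2.trans hs.2⟩
        have a1 := abs_real_inner_le_norm (y u) x
        have a2 := abs_real_inner_le_norm (y u) z
        have a3 := abs_real_inner_le_norm (covAccel y u) x
        have a4 := abs_real_inner_le_norm (covAccel y u) z
        rw [hyu, hx, one_mul] at a1
        rw [hyu, hz, one_mul] at a2
        rw [hx, mul_one] at a3
        rw [hz, mul_one] at a4
        refine (norm_sub_le _ _).trans ?_
        rw [Real.norm_eq_abs, Real.norm_eq_abs, abs_mul, abs_mul]
        have := mul_le_mul a1 a4 (abs_nonneg _) zero_le_one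
        have := mul_le_mul a3 a2 (abs_nonneg _) (norm_nonneg _)
        linarith)
      (Continuous.intervalIntegrable (by fun_prop) _ _)
    rw [hftc, Real.norm_eq_abs] at hbound
    have := (abs_le.1 (hbound.trans (haccint s hs))).1
    linarith
  -- hence `y` stays close to the great circle `c`
  have hphi : ∀ s ∈ Set.Icc (0:ℝ) 1, 1 - 2 * ε ≤ ⟪y s, c s⟫ := by
    have hd : ∀ s, HasDerivAt (fun s => ⟪y s, c s⟫ + 2 * ε * s)
        (⟪y s, (-(v * Real.sin (v * s))) • p + (v * Real.cos (v * s)) • e⟫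
          + ⟪deriv y s, c s⟫ + 2 * ε) s := fun s => by
      exact (((hy.hasDerivAt_deriv_two s).1.inner ℝ (hcderiv s)).add
        ((hasDerivAt_id s).const_mul (2 * ε))).congr_deriv (by simp)
    have hmono : MonotoneOn (fun s => ⟪y s, c s⟫ + 2 * ε * s) (Set.Icc (0:ℝ) 1) := by
      apply monotoneOn_of_deriv_nonneg (convex_Icc 0 1)
        (fun s _ => (hd s).continuousAt.continuousWithinAt)
        (fun s _ => (hd s).differentiableAt.differentiableWithinAt)
      intro s hs
      replace hs := interior_subset hs
      rw [(hd s).deriv]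
      have h1 := hmom (y s) (c s) (hunit s hs) (hcnorm s) s hs
      have h2 : ⟪y s, y s⟫ = (1:ℝ) := by
        rw [real_inner_self_eq_norm_sq, hunit s hs, one_pow]
      have h3 : ⟪deriv y s, y s⟫ = (0:ℝ) := by rw [real_inner_comm, htang s hs]
      rw [h2, h3] at h1
      have h4 : ⟪p, c s⟫ = Real.cos (v * s) := by
        simp only [hc, inner_add_right, inner_smul_right, hpp]
        rcases hpe with h | ⟨-, h, -⟩ <;> simp [h]
      have h5 : ⟪deriv y 0, c s⟫ = v * Real.sin (v * s) := by
        rw [hve]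
        simp only [hc, inner_add_right, inner_smul_right, inner_smul_left, conj_trivial]
        rcases hpe with h | ⟨h, -, h'⟩
        · simp [h]
        · rw [h, h']; ring
      rw [h4, h5, hve] at h1
      simp only [inner_add_right, inner_smul_right, inner_smul_left, conj_trivial] at h1 ⊢
      rw [real_inner_comm (y s) p, real_inner_comm (y s) e] at h1
      linarith
    intro s hs
    have := hmono (Set.left_mem_Icc.2 zero_le_one) hs hs.1
    simp only [hc, mul_zero, Real.cos_zero, one_smul, Real.sin_zero, zero_smul, add_zero] at this
    rw [← hp, hpp] at this
    simp only [hc]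
    nlinarith [hs.1, hs.2]
  have hyc : ‖y s - c s‖ ≤ 2 * √ε := by
    rw [← sq_le_sq₀ (norm_nonneg _) (by positivity), norm_sub_sq_real, hunit s hs, hcnorm s,
      mul_pow, Real.sq_sqrt hε.le]
    linarith [hphi s hs]
  have hcp : ‖c s - p‖ = √(2 - 2 * Real.cos (v * s)) := by
    have h4 : ⟪c s, p⟫ = Real.cos (v * s) := by
      simp only [hc, inner_add_left, inner_smul_left, hpp, conj_trivial]
      rcases hpe with h | ⟨-, -, h⟩ <;> simp [h]
    rw [← Real.sqrt_sq (norm_nonneg (c s - p)), norm_sub_sq_real, hcnorm, h4, hp,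
      hunit 0 (by simp)]
    congr 1
    ring
  calc ‖y s - p‖ ≤ ‖y s - c s‖ + ‖c s - p‖ := norm_sub_le_norm_sub_add_norm_sub _ _ _
    _ ≤ _ := by rw [hcp]; gcongr

theorem ContDiff.normalize {x : ℝ → E} (hx : ContDiff ℝ 2 x) (h0 : ∀ t, x t ≠ 0) :
    ContDiff ℝ 2 fun t => ‖x t‖⁻¹ • x t :=
  ((hx.norm ℝ h0).inv fun t => norm_ne_zero_iff.2 (h0 t)).smul hx

theorem norm_normalize {x : E} (h0 : x ≠ 0) : ‖‖x‖⁻¹ • x‖ = 1 := by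
  rw [norm_smul, norm_inv, norm_norm, inv_mul_cancel₀ (norm_ne_zero_iff.2 h0)]

theorem deriv_inv_norm {x : ℝ → E} (hx : ContDiff ℝ 2 x) (h0 : ∀ t, x t ≠ 0) (t : ℝ) :
    deriv (fun t => ‖x t‖⁻¹) t = -((‖x t‖⁻¹) ^ 3 * ⟪x t, deriv x t⟫) := by
  have hρ : ContDiff ℝ 2 fun t => ‖x t‖⁻¹ :=
    (hx.norm ℝ h0).inv fun t => norm_ne_zero_iff.2 (h0 t)
  have hpos : 0 < ‖x t‖ := norm_pos_iff.2 (h0 t)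
  have hd := (hρ.hasDerivAt_deriv_two t).1.smul (hx.hasDerivAt_deriv_two t).1
  have htang := inner_deriv_eq_zero (hx.normalize h0) (a := t) (b := t + 1) (by linarith)
    (fun s _ => norm_normalize (h0 s)) t (by simp)
  have hd' : deriv (fun t => ‖x t‖⁻¹ • x t) t
      = ‖x t‖⁻¹ • deriv x t + deriv (fun t => ‖x t‖⁻¹) t • x t := hd.deriv
  rw [hd', inner_smul_left, inner_add_right, inner_smul_right, inner_smul_right,
    real_inner_self_eq_norm_sq, conj_trivial] at htang
  have := (mul_eq_zero.1 htang).resolve_left (inv_ne_zero hpos.ne')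
  field_simp at this ⊢
  linarith

theorem deriv_normalize {x : ℝ → E} (hx : ContDiff ℝ 2 x) (h0 : ∀ t, x t ≠ 0) {t : ℝ}
    (h1 : ‖x t‖ = 1) (hperp : ⟪x t, deriv x t⟫ = 0) :
    deriv (fun t => ‖x t‖⁻¹ • x t) t = deriv x t := by
  have hρ : ContDiff ℝ 2 fun t => ‖x t‖⁻¹ :=
    (hx.norm ℝ h0).inv fun t => norm_ne_zero_iff.2 (h0 t)
  have hd := (hρ.hasDerivAt_deriv_two t).1.smul (hx.hasDerivAt_deriv_two t).1
  refine hd.deriv.trans ?_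
  rw [deriv_inv_norm hx h0, hperp, h1]
  simp

theorem norm_sub_inner_smul_le {n : E} (hn : ‖n‖ = 1) (z : E) : ‖z - ⟪n, z⟫ • n‖ ≤ ‖z‖ := by
  rw [← sq_le_sq₀ (norm_nonneg _) (norm_nonneg _), norm_sub_sq_real, inner_smul_right, norm_smul,
    hn, real_inner_comm, Real.norm_eq_abs, mul_one, sq_abs]
  nlinarith [sq_nonneg ⟪n, z⟫, real_inner_comm n z]

/-- The covariant acceleration of the radial projection of a curve to the sphere. -/
theorem norm_covAccel_normalize_le {x : ℝ → E} (hx : ContDiff ℝ 2 x) (h0 : ∀ t, x t ≠ 0) (t : ℝ) :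
    ‖covAccel (fun t => ‖x t‖⁻¹ • x t) t‖ ≤
      ‖x t‖⁻¹ * ‖deriv (deriv x) t‖ + 2 * (‖x t‖⁻¹ * ‖deriv x t‖) ^ 2 := by
  set ρ : ℝ → ℝ := fun t => ‖x t‖⁻¹ with hρdef
  set n : ℝ → E := fun t => ρ t • x t with hndef
  have hρ : ContDiff ℝ 2 ρ := (hx.norm ℝ h0).inv fun t => norm_ne_zero_iff.2 (h0 t)
  have hn : ContDiff ℝ 2 n := hx.normalize h0
  have hunit : ∀ t, ‖n t‖ = 1 := fun t => norm_normalize (h0 t)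
  have hpos : 0 < ‖x t‖ := norm_pos_iff.2 (h0 t)
  have htang : ∀ t, ⟪n t, deriv n t⟫ = 0 := fun t =>
    inner_deriv_eq_zero hn (a := t) (b := t + 1) (by linarith) (fun s _ => hunit s) t (by simp)
  have hnorm : ⟪n t, deriv (deriv n) t⟫ = -‖deriv n t‖ ^ 2 := by
    obtain ⟨h1, h2, -, -⟩ := hn.hasDerivAt_deriv_two t
    have h3 := (h1.inner ℝ h2).deriv
    rw [funext htang, deriv_const, real_inner_self_eq_norm_sq] at h3
    linarith
  have hn' : deriv n = fun t => ρ t • deriv x t + deriv ρ t • x t := funext fun t =>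
    ((hρ.hasDerivAt_deriv_two t).1.smul (hx.hasDerivAt_deriv_two t).1).deriv
  set z := ρ t • deriv (deriv x) t + (2 * deriv ρ t) • deriv x t with hz
  have hn'' : deriv (deriv n) t = z + (deriv (deriv ρ) t * ‖x t‖) • n t := by
    obtain ⟨h1, h2, -, -⟩ := hρ.hasDerivAt_deriv_two t
    obtain ⟨k1, k2, -, -⟩ := hx.hasDerivAt_deriv_two t
    rw [hn']
    refine ((h1.smul k2).add (h2.smul k1)).deriv.trans ?_
    have : (deriv (deriv ρ) t * ‖x t‖) • n t = deriv (deriv ρ) t • x t := by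
      rw [hndef, smul_smul, mul_assoc, hρdef]
      simp only
      rw [mul_inv_cancel₀ hpos.ne', mul_one]
    rw [this, hz]
    module
  have hacc : covAccel n t = z - ⟪n t, z⟫ • n t := by
    have h1 : ‖deriv n t‖ ^ 2 = -⟪n t, deriv (deriv n) t⟫ := by rw [hnorm, neg_neg]
    rw [covAccel, h1, hn'', inner_add_right, inner_smul_right, real_inner_self_eq_norm_sq,
      hunit]
    module
  rw [hacc]
  refine (norm_sub_inner_smul_le (hunit t) z).trans ((norm_add_le _ _).trans ?_)
  have hρt : ρ t = ‖x t‖⁻¹ := rfl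
  have hρpos : 0 < ρ t := inv_pos.2 hpos
  rw [norm_smul, norm_smul, Real.norm_of_nonneg hρpos.le, Real.norm_eq_abs, abs_mul, abs_two,
    deriv_inv_norm hx h0 t, abs_neg, abs_mul, abs_of_nonneg (by positivity), ← hρt]
  have h1 := abs_real_inner_le_norm (x t) (deriv x t)
  have h2 : ρ t * ‖x t‖ = 1 := inv_mul_cancel₀ hpos.ne'
  have h3 : ρ t ^ 3 * |⟪x t, deriv x t⟫| ≤ ρ t ^ 2 * ‖deriv x t‖ := by
    calc ρ t ^ 3 * |⟪x t, deriv x t⟫| ≤ ρ t ^ 3 * (‖x t‖ * ‖deriv x t‖) := by gcongr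
      _ = ρ t ^ 2 * (ρ t * ‖x t‖) * ‖deriv x t‖ := by ring
      _ = _ := by rw [h2, mul_one]
  have h4 := mul_le_mul_of_nonneg_right h3 (norm_nonneg (deriv x t))
  nlinarith

/-- A segment from `P` to the antipode of `e` stays away from the origin. -/
theorem le_norm_smul_sub_smul {P e : E} {s Y u : ℝ} (hs : 0 ≤ s) (hY : 0 ≤ Y) (hsY : s + Y = 1)
    (he : ‖e‖ = 1) (hP1 : 1 ≤ ‖P‖) (hP2 : ‖P‖ ≤ 2) (hu : -1 ≤ u) (hPe : ⟪P, e⟫ ≤ u) :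
    (1 - u) / 8 ≤ ‖s • P - Y • e‖ := by
  have hY' : ‖Y • e‖ = Y := by rw [norm_smul, he, mul_one, Real.norm_of_nonneg hY]
  have hs' : ‖s • P‖ = s * ‖P‖ := by rw [norm_smul, Real.norm_of_nonneg hs]
  have h1 := norm_sub_norm_le (s • P) (Y • e)
  have h2 := norm_sub_norm_le (Y • e) (s • P)
  rw [norm_sub_rev] at h2
  have h3 := (abs_le.1 (abs_real_inner_le_norm (s • P - Y • e) e)).1
  rw [inner_sub_left, inner_smul_left, inner_smul_left, real_inner_self_eq_norm_sq, he,
    conj_trivial, conj_trivial] at h3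
  rw [hY', hs'] at h1 h2
  rcases le_or_gt (1 / 4) s with h | h <;> nlinarith

/-- Along a segment from `P` to the antipode of `e`, the angle with `e` increases at a definite
rate. -/
theorem inner_smul_sub_smul_le {P e : E} {s Y Y₀ k κ : ℝ} (hs : 0 ≤ s) (hY₀ : 0 < Y₀)
    (hY : Y₀ ≤ Y) (hsY : s + Y = 1) (he : ‖e‖ = 1) (hκ : 0 < κ) (hκ1 : κ ≤ 1 - k)
    (hκ2 : κ ≤ 1 + k) (hP1 : 1 ≤ ‖P‖) (hP2 : ‖P‖ ≤ 1 + κ * Y₀ / 8)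
    (hPe : ⟪P, e⟫ ≤ k + κ * Y₀ / 8) :
    ⟪s • P - Y • e, e⟫ ≤ (k - κ * Y₀ / 8) * ‖s • P - Y • e‖ := by
  have hYpos : 0 ≤ Y := hY₀.le.trans hY
  have hY' : ‖Y • e‖ = Y := by rw [norm_smul, he, mul_one, Real.norm_of_nonneg hYpos]
  have hs' : ‖s • P‖ = s * ‖P‖ := by rw [norm_smul, Real.norm_of_nonneg hs]
  have h1 := norm_sub_norm_le (s • P) (Y • e)
  have h2 := norm_sub_le (s • P) (Y • e)
  rw [inner_sub_left, inner_smul_left, inner_smul_left, real_inner_self_eq_norm_sq, he,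
    conj_trivial, conj_trivial]
  rw [hY', hs'] at h1 h2
  set d := κ * Y₀ / 8 with hd
  have hd0 : 0 < d := by positivity
  have hs1 : s ≤ 1 := by linarith
  have hκ1' : κ ≤ 1 := by linarith
  have hdκ : 8 * d ≤ κ * Y := by rw [hd]; nlinarith
  have hA : s * ⟪P, e⟫ ≤ s * (k + d) := by gcongr
  have hsd : s * d ≤ d := by nlinarith
  rcases le_or_gt 0 (k - d) with h | h
  · have h3 : s - Y ≤ ‖s • P - Y • e‖ := by nlinarith
    have h4 := mul_le_mul_of_nonneg_left h3 h
    nlinarith [mul_nonneg hYpos (sub_nonneg.2 hκ1), mul_nonneg hYpos hd0.le]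
  · have h3 : ‖s • P - Y • e‖ ≤ s + s * d + Y := by nlinarith
    have h4 := mul_le_mul_of_nonpos_left h3 h.le
    have h5 : s * d * (-(k - d)) ≤ d * 2 := by
      apply mul_le_mul hsd _ (by linarith) hd0.le
      nlinarith
    have h6 : Y * d ≤ d := by nlinarith
    nlinarith [mul_nonneg hYpos (sub_nonneg.2 hκ2)]


theorem Real.smoothTransition.contDiff_two : ContDiff ℝ 2 Real.smoothTransition :=
  Real.smoothTransition.contDiff (n := 2)

theorem Real.smoothTransition.deriv_of_nonpos {x : ℝ} (hx : x ≤ 0) :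
    deriv Real.smoothTransition x = 0 :=
  IsLocalMin.deriv_eq_zero (Filter.Eventually.of_forall fun y => by
    rw [Real.smoothTransition.zero_of_nonpos hx]
    exact Real.smoothTransition.nonneg y)

theorem Real.smoothTransition.deriv_of_one_le {x : ℝ} (hx : 1 ≤ x) :
    deriv Real.smoothTransition x = 0 :=
  IsLocalMax.deriv_eq_zero (Filter.Eventually.of_forall fun y => by
    rw [Real.smoothTransition.one_of_one_le hx]
    exact Real.smoothTransition.le_one y)

theorem Real.smoothTransition.exists_deriv_bound :
    ∃ K, 0 < K ∧ ∀ x, |deriv Real.smoothTransition x| ≤ K ∧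
      |deriv (deriv Real.smoothTransition) x| ≤ K := by
  obtain ⟨-, -, h1, h2⟩ := Real.smoothTransition.contDiff_two.hasDerivAt_deriv_two 0
  have hsupp : HasCompactSupport (deriv Real.smoothTransition) := by
    refine HasCompactSupport.intro (isCompact_Icc (a := (0:ℝ)) (b := 1)) fun x hx => ?_
    rcases le_or_gt x 0 with h | h
    · exact Real.smoothTransition.deriv_of_nonpos h
    · exact Real.smoothTransition.deriv_of_one_le (not_le.1 fun h' => hx ⟨h.le, h'⟩).le
  obtain ⟨C₁, hC₁⟩ := h1.bounded_above_of_compact_support hsupp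
  obtain ⟨C₂, hC₂⟩ := h2.bounded_above_of_compact_support hsupp.deriv
  refine ⟨max 1 (max C₁ C₂), by positivity, fun x => ⟨?_, ?_⟩⟩
  · exact (hC₁ x).trans ((le_max_left _ _).trans (le_max_right _ _))
  · exact (hC₂ x).trans ((le_max_right _ _).trans (le_max_right _ _))

/-- The deviation from the antipode `-e` of a curve which starts at `p` with velocity `w` and
reaches `-e` at time `l`. -/
noncomputable def boundaryLayer (e p w : E) (l t : ℝ) : E :=
  (1 - Real.smoothTransition (t / l)) • (p + t • w + e)

theorem contDiff_boundaryLayer (e p w : E) (l : ℝ) : ContDiff ℝ 2 (boundaryLayer e p w l) := by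
  have := Real.smoothTransition.contDiff_two
  unfold boundaryLayer
  exact (contDiff_const.sub (this.comp (contDiff_id.div_const l))).smul (by fun_prop)

theorem boundaryLayer_of_le {e p w : E} {l t : ℝ} (hl : 0 < l) (ht : l ≤ t) :
    boundaryLayer e p w l t = 0 := by
  rw [boundaryLayer, Real.smoothTransition.one_of_one_le ((one_le_div hl).2 ht), sub_self,
    zero_smul]

theorem boundaryLayer_sub (e p w : E) (l t : ℝ) :
    boundaryLayer e p w l t - e = (1 - Real.smoothTransition (t / l)) • (p + t • w)
      - Real.smoothTransition (t / l) • e := by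
  rw [boundaryLayer]
  module

theorem deriv_boundaryLayer (e p w : E) (l t : ℝ) :
    deriv (boundaryLayer e p w l) t =
      (1 - Real.smoothTransition (t / l)) • w
        - (deriv Real.smoothTransition (t / l) / l) • (p + t • w + e) := by
  have h0 := (Real.smoothTransition.contDiff_two.hasDerivAt_deriv_two (t / l)).1
  have h1 : HasDerivAt (fun t => 1 - Real.smoothTransition (t / l))
      (-(deriv Real.smoothTransition (t / l) / l)) t := by
    refine ((h0.comp t ((hasDerivAt_id t).div_const l)).const_sub 1).congr_deriv ?_
    ring
  have h2 : HasDerivAt (fun t : ℝ => p + t • w + e) w t := by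
    simpa using (((hasDerivAt_id t).smul_const w).const_add p).add_const e
  refine (h1.smul h2).deriv.trans ?_
  module

theorem deriv_deriv_boundaryLayer (e p w : E) (l t : ℝ) :
    deriv (deriv (boundaryLayer e p w l)) t =
      -((2 * deriv Real.smoothTransition (t / l) / l) • w)
        - (deriv (deriv Real.smoothTransition) (t / l) / l ^ 2) • (p + t • w + e) := by
  obtain ⟨h0, h0', -, -⟩ := Real.smoothTransition.contDiff_two.hasDerivAt_deriv_two (t / l)
  have h1 : HasDerivAt (fun t => 1 - Real.smoothTransition (t / l))
      (-(deriv Real.smoothTransition (t / l) / l)) t := by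
    refine ((h0.comp t ((hasDerivAt_id t).div_const l)).const_sub 1).congr_deriv ?_
    ring
  have h1' : HasDerivAt (fun t => deriv Real.smoothTransition (t / l) / l)
      (deriv (deriv Real.smoothTransition) (t / l) / l ^ 2) t := by
    refine ((h0'.comp t ((hasDerivAt_id t).div_const l)).div_const l).congr_deriv ?_
    ring
  have h2 : HasDerivAt (fun t : ℝ => p + t • w + e) w t := by
    simpa using (((hasDerivAt_id t).smul_const w).const_add p).add_const e
  rw [funext (deriv_boundaryLayer e p w l)]
  refine ((h1.smul_const w).sub (h1'.smul h2)).deriv.trans ?_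
  module

theorem exists_norm_deriv_boundaryLayer_le (T : ℝ) (hT : 0 < T) {e p : E} (he : ‖e‖ = 1)
    (hp : ‖p‖ = 1) (w : E) : ∃ C, 0 < C ∧ ∀ l, 0 < l → l ≤ 1 → ∀ t ∈ Set.Icc 0 T,
      ‖deriv (boundaryLayer e p w l) t‖ ≤ C / l ∧
        ‖deriv (deriv (boundaryLayer e p w l)) t‖ ≤ C / l ^ 2 := by
  obtain ⟨K, hK, hKb⟩ := Real.smoothTransition.exists_deriv_bound
  refine ⟨‖w‖ + 2 * K * ‖w‖ + K * (2 + T * ‖w‖), by positivity, fun l hl hl1 t ht => ?_⟩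
  have hP : ‖p + t • w + e‖ ≤ 2 + T * ‖w‖ := by
    calc ‖p + t • w + e‖ ≤ ‖p‖ + ‖t • w‖ + ‖e‖ := norm_add₃_le
      _ = 2 + t * ‖w‖ := by rw [he, hp, norm_smul, Real.norm_of_nonneg ht.1]; ring
      _ ≤ 2 + T * ‖w‖ := by gcongr; exact ht.2
  obtain ⟨hb1, hb2⟩ := hKb (t / l)
  have hY : |1 - Real.smoothTransition (t / l)| ≤ 1 := by
    rw [abs_of_nonneg (sub_nonneg.2 (Real.smoothTransition.le_one _))]
    linarith [Real.smoothTransition.nonneg (t / l)]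
  constructor
  · rw [deriv_boundaryLayer]
    refine (norm_sub_le _ _).trans ?_
    rw [norm_smul, norm_smul, Real.norm_eq_abs, Real.norm_eq_abs, abs_div, abs_of_pos hl]
    calc |1 - Real.smoothTransition (t / l)| * ‖w‖
          + |deriv Real.smoothTransition (t / l)| / l * ‖p + t • w + e‖
        ≤ 1 * ‖w‖ + K / l * (2 + T * ‖w‖) := by gcongr
      _ ≤ ‖w‖ / l + 2 * K * ‖w‖ / l + K / l * (2 + T * ‖w‖) := by
          have : ‖w‖ ≤ ‖w‖ / l := le_div_self (norm_nonneg _) hl hl1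
          have : 0 ≤ 2 * K * ‖w‖ / l := by positivity
          linarith
      _ = _ := by ring
  · rw [deriv_deriv_boundaryLayer]
    refine (norm_sub_le _ _).trans ?_
    rw [norm_neg, norm_smul, norm_smul, Real.norm_eq_abs, Real.norm_eq_abs, abs_div, abs_div,
      abs_mul, abs_two, abs_of_pos hl, abs_of_pos (pow_pos hl 2)]
    calc 2 * |deriv Real.smoothTransition (t / l)| / l * ‖w‖
          + |deriv (deriv Real.smoothTransition) (t / l)| / l ^ 2 * ‖p + t • w + e‖
        ≤ 2 * K / l * ‖w‖ + K / l ^ 2 * (2 + T * ‖w‖) := by gcongr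
      _ ≤ ‖w‖ / l ^ 2 + 2 * K * ‖w‖ / l / l + K / l ^ 2 * (2 + T * ‖w‖) := by
          have : 2 * K * ‖w‖ / l ≤ 2 * K * ‖w‖ / l / l := le_div_self (by positivity) hl hl1
          have : 0 ≤ ‖w‖ / l ^ 2 := by positivity
          have : 2 * K / l * ‖w‖ = 2 * K * ‖w‖ / l := by ring
          linarith
      _ = _ := by ring

theorem one_le_norm_add_smul {p w : E} (hp : ‖p‖ = 1) (hpw : ⟪p, w⟫ = 0) (t : ℝ) :
    1 ≤ ‖p + t • w‖ := by
  rw [← sq_le_sq₀ zero_le_one (norm_nonneg _), norm_add_sq_real, hp, inner_smul_right, hpw]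
  nlinarith [sq_nonneg ‖t • w‖]

theorem norm_add_smul_le {p w : E} (hp : ‖p‖ = 1) {t l : ℝ} (ht : 0 ≤ t) (htl : t ≤ l) :
    ‖p + t • w‖ ≤ 1 + l * ‖w‖ := by
  refine (norm_add_le _ _).trans ?_
  rw [hp, norm_smul, Real.norm_of_nonneg ht]
  gcongr

theorem inner_add_smul_le {e p w : E} (he : ‖e‖ = 1) {k : ℝ} (hpe : ⟪p, e⟫ ≤ k) {t l : ℝ}
    (ht : 0 ≤ t) (htl : t ≤ l) : ⟪p + t • w, e⟫ ≤ k + l * ‖w‖ := by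
  rw [inner_add_left, inner_smul_left, conj_trivial]
  have h1 : ⟪w, e⟫ ≤ ‖w‖ := by simpa [he] using real_inner_le_norm w e
  have h2 : t * ⟪w, e⟫ ≤ t * ‖w‖ := by gcongr
  have h3 : t * ‖w‖ ≤ l * ‖w‖ := by gcongr
  linarith

theorem le_norm_boundaryLayer_sub {e p w : E} {k l : ℝ} (he : ‖e‖ = 1) (hp : ‖p‖ = 1)
    (hpw : ⟪p, w⟫ = 0) (hpe : ⟪p, e⟫ ≤ k) (hk : -1 < k) (hl : 0 < l)
    (hlw : l * ‖w‖ ≤ (1 - k) / 2) (t : ℝ) : (1 - k) / 16 ≤ ‖boundaryLayer e p w l t - e‖ := by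
  rcases le_or_gt l t with h | h
  · rw [boundaryLayer_of_le hl h, zero_sub, norm_neg, he]
    linarith
  rw [boundaryLayer_sub]
  rcases le_or_gt t 0 with h0 | h0
  · rw [Real.smoothTransition.zero_of_nonpos (div_nonpos_of_nonpos_of_nonneg h0 hl.le), sub_zero,
      one_smul, zero_smul, sub_zero]
    linarith [one_le_norm_add_smul hp hpw t]
  · have h1 := norm_add_smul_le (w := w) hp h0.le h.le
    have h2 := inner_add_smul_le (w := w) he hpe h0.le h.le
    have := le_norm_smul_sub_smul (P := p + t • w) (u := (1 + k) / 2)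
      (sub_nonneg.2 (Real.smoothTransition.le_one (t / l))) (Real.smoothTransition.nonneg (t / l))
      (by ring) he (one_le_norm_add_smul hp hpw t) (by linarith) (by linarith) (by linarith)
    linarith

theorem inner_boundaryLayer_sub_le {e p w : E} {k κ l σ t : ℝ} (he : ‖e‖ = 1) (hp : ‖p‖ = 1)
    (hpw : ⟪p, w⟫ = 0) (hpe : ⟪p, e⟫ ≤ k) (hκ : 0 < κ) (hκ1 : κ ≤ 1 - k) (hκ2 : κ ≤ 1 + k)
    (hσ : 0 < σ) (hl : 0 < l) (hlw : l * ‖w‖ ≤ κ * Real.smoothTransition σ / 8)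
    (ht : σ * l ≤ t) :
    ⟪boundaryLayer e p w l t - e, e⟫ ≤
      (k - κ * Real.smoothTransition σ / 8) * ‖boundaryLayer e p w l t - e‖ := by
  have hσ1 := Real.smoothTransition.le_one σ
  have hσ0 := Real.smoothTransition.pos_of_pos hσ
  rcases le_or_gt l t with h | h
  · rw [boundaryLayer_of_le hl h, zero_sub, norm_neg, he, inner_neg_left,
      real_inner_self_eq_norm_sq, he]
    nlinarith
  rw [boundaryLayer_sub]
  have h0 : 0 ≤ t := (by positivity : 0 ≤ σ * l).trans ht
  have h1 := norm_add_smul_le (w := w) hp h0 h.le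
  have h2 := inner_add_smul_le (w := w) he hpe h0 h.le
  exact inner_smul_sub_smul_le (sub_nonneg.2 (Real.smoothTransition.le_one (t / l))) hσ0
    (Real.smoothTransition.monotone ((le_div_iff₀ hl).2 ht)) (by ring) he hκ hκ1 hκ2
    (one_le_norm_add_smul hp hpw t) (by linarith) (by linarith)

/-- Competitors which move from the boundary data to the antipode of `e` in time `l`, stay there,
and come back in time `l`. -/
theorem exists_competitor {T k : ℝ} (hT : 0 < T) {e p₀ pT v₀ vT : E} (he : ‖e‖ = 1)
    (hp₀ : ‖p₀‖ = 1) (hpT : ‖pT‖ = 1) (hv₀ : ⟪p₀, v₀⟫ = 0) (hvT : ⟪pT, vT⟫ = 0)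
    (hk1 : -1 < k) (hk2 : k < 1) (h₀ : ⟪p₀, e⟫ ≤ k) (h_T : ⟪pT, e⟫ ≤ k) :
    ∃ C, 0 < C ∧ ∀ σ, 0 < σ → ∃ d, 0 < d ∧ -1 < k - d ∧ ∃ l₀, 0 < l₀ ∧ l₀ ≤ T / 2 ∧
      ∀ l, 0 < l → l ≤ l₀ → ∃ m : ℝ → E, ContDiff ℝ 2 m ∧ (∀ t, ‖m t‖ = 1) ∧
        (m 0 = p₀ ∧ deriv m 0 = v₀ ∧ m T = pT ∧ deriv m T = vT) ∧
        (∀ t ∈ Set.Icc 0 T, ‖covAccel m t‖ ≤ C / l ^ 2) ∧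
        (∀ t ∈ Set.Ioo l (T - l), covAccel m t = 0 ∧ m t = -e) ∧
        ∀ t ∈ Set.Icc (σ * l) (T - σ * l), ⟪m t, e⟫ ≤ k - d := by
  obtain ⟨C₁, hC₁, hb₁⟩ := exists_norm_deriv_boundaryLayer_le T hT he hp₀ v₀
  obtain ⟨C₂, hC₂, hb₂⟩ := exists_norm_deriv_boundaryLayer_le T hT he hpT (-vT)
  set c := (1 - k) / 16 with hc
  have hcpos : 0 < c := by rw [hc]; linarith
  refine ⟨c⁻¹ * (C₁ + C₂) + 2 * (c⁻¹ * (C₁ + C₂)) ^ 2, by positivity, fun σ hσ => ?_⟩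
  set κ := min (1 - k) (1 + k) with hκdef
  have hκ : 0 < κ := lt_min (by linarith) (by linarith)
  have hκ1 : κ ≤ 1 - k := min_le_left _ _
  have hκ2 : κ ≤ 1 + k := min_le_right _ _
  have hY := Real.smoothTransition.pos_of_pos hσ
  have hY1 := Real.smoothTransition.le_one σ
  set d := κ * Real.smoothTransition σ / 8 with hd
  have hdpos : 0 < d := by positivity
  have hdκ : d ≤ κ / 8 := by rw [hd]; gcongr; nlinarith
  set W := ‖v₀‖ + ‖vT‖ + 1 with hW
  have hWpos : 0 < W := by positivity
  refine ⟨d, hdpos, by linarith, min (min 1 (T / 2)) (d / W), by positivity,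
    (min_le_left _ _).trans (min_le_right _ _), fun l hl hll => ?_⟩
  have hl1 : l ≤ 1 := hll.trans ((min_le_left _ _).trans (min_le_left _ _))
  have hlT : l ≤ T / 2 := hll.trans ((min_le_left _ _).trans (min_le_right _ _))
  have hlW : l * W ≤ d := (le_div_iff₀ hWpos).1 (hll.trans (min_le_right _ _))
  have hlv₀ : l * ‖v₀‖ ≤ d := by
    refine le_trans ?_ hlW
    gcongr
    linarith [norm_nonneg vT]
  have hlvT : l * ‖-vT‖ ≤ d := by
    rw [norm_neg]
    refine le_trans ?_ hlW
    gcongr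
    linarith [norm_nonneg v₀]
  have hvT' : ⟪pT, -vT⟫ = 0 := by rw [inner_neg_right, hvT, neg_zero]
  set y₁ := boundaryLayer e p₀ v₀ l with hy₁
  set y₂ := boundaryLayer e pT (-vT) l with hy₂
  have hs₁ : ContDiff ℝ 2 y₁ := contDiff_boundaryLayer _ _ _ _
  have hs₂ : ContDiff ℝ 2 y₂ := contDiff_boundaryLayer _ _ _ _
  set x : ℝ → E := fun t => y₁ t + y₂ (T - t) - e with hx
  have hxs : ContDiff ℝ 2 x :=
    (hs₁.add (hs₂.comp (contDiff_const.sub contDiff_id))).sub contDiff_const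
  have hside : ∀ t, (t ≤ T / 2 ∧ x t = y₁ t - e) ∨ (T / 2 ≤ t ∧ x t = y₂ (T - t) - e) := by
    intro t
    rcases le_total t (T / 2) with h | h
    · left
      refine ⟨h, ?_⟩
      simp only [hx, hy₂]
      rw [boundaryLayer_of_le hl (by linarith), add_zero]
    · right
      refine ⟨h, ?_⟩
      simp only [hx, hy₁]
      rw [boundaryLayer_of_le hl (by linarith), zero_add]
  have hxnorm : ∀ t, c ≤ ‖x t‖ := by
    intro t
    rcases hside t with ⟨-, h⟩ | ⟨-, h⟩ <;> rw [h]
    · exact le_norm_boundaryLayer_sub he hp₀ hv₀ h₀ hk1 hl (by linarith) _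
    · exact le_norm_boundaryLayer_sub he hpT hvT' h_T hk1 hl (by linarith) _
  have hx0 : ∀ t, x t ≠ 0 := fun t => norm_pos_iff.1 (hcpos.trans_le (hxnorm t))
  have hx' : deriv x = fun t => deriv y₁ t - deriv y₂ (T - t) := by
    funext t
    have h1 := (hs₁.hasDerivAt_deriv_two t).1
    have h2 := (hs₂.hasDerivAt_deriv_two (T - t)).1.comp_const_sub T t
    exact ((h1.add h2).sub_const e).deriv.trans (sub_eq_add_neg _ _).symm
  have hx'' : ∀ t, deriv (deriv x) t = deriv (deriv y₁) t + deriv (deriv y₂) (T - t) := by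
    intro t
    rw [hx']
    have h1 := (hs₁.hasDerivAt_deriv_two t).2.1
    have h2 := (hs₂.hasDerivAt_deriv_two (T - t)).2.1.comp_const_sub T t
    exact (h1.sub h2).deriv.trans (sub_neg_eq_add _ _)
  have hTl : 1 ≤ T / l := (one_le_div hl).2 (by linarith)
  have hx_zero : x 0 = p₀ := by
    simp [hx, hy₁, hy₂, boundaryLayer, Real.smoothTransition.zero,
      Real.smoothTransition.one_of_one_le hTl]
  have hx_T : x T = pT := by
    simp [hx, hy₁, hy₂, boundaryLayer, Real.smoothTransition.zero,
      Real.smoothTransition.one_of_one_le hTl]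
  have hx'_zero : deriv x 0 = v₀ := by
    simp [hx', hy₁, hy₂, deriv_boundaryLayer, Real.smoothTransition.zero,
      Real.smoothTransition.deriv_of_nonpos le_rfl, Real.smoothTransition.deriv_of_one_le hTl,
      Real.smoothTransition.one_of_one_le hTl]
  have hx'_T : deriv x T = vT := by
    simp [hx', hy₁, hy₂, deriv_boundaryLayer, Real.smoothTransition.zero,
      Real.smoothTransition.deriv_of_nonpos le_rfl, Real.smoothTransition.deriv_of_one_le hTl,
      Real.smoothTransition.one_of_one_le hTl]
  refine ⟨fun t => ‖x t‖⁻¹ • x t, hxs.normalize hx0, fun t => norm_normalize (hx0 t),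
    ⟨by simp [hx_zero, hp₀], ?_, by simp [hx_T, hpT], ?_⟩, fun t ht => ?_, fun t ht => ?_,
    fun t ht => ?_⟩
  · rw [deriv_normalize hxs hx0 (by rw [hx_zero, hp₀]) (by rw [hx_zero, hx'_zero, hv₀]), hx'_zero]
  · rw [deriv_normalize hxs hx0 (by rw [hx_T, hpT]) (by rw [hx_T, hx'_T, hvT]), hx'_T]
  · refine (norm_covAccel_normalize_le hxs hx0 t).trans ?_
    obtain ⟨a1, a2⟩ := hb₁ l hl hl1 t ht
    obtain ⟨b1, b2⟩ := hb₂ l hl hl1 (T - t) ⟨by linarith [ht.2], by linarith [ht.1]⟩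
    have hinv : ‖x t‖⁻¹ ≤ c⁻¹ := inv_anti₀ hcpos (hxnorm t)
    have e1 : ‖deriv x t‖ ≤ (C₁ + C₂) / l := by
      rw [hx', add_div]
      exact (norm_sub_le _ _).trans (add_le_add a1 b1)
    have e2 : ‖deriv (deriv x) t‖ ≤ (C₁ + C₂) / l ^ 2 := by
      rw [hx'', add_div]
      exact (norm_add_le _ _).trans (add_le_add a2 b2)
    calc ‖x t‖⁻¹ * ‖deriv (deriv x) t‖ + 2 * (‖x t‖⁻¹ * ‖deriv x t‖) ^ 2
        ≤ c⁻¹ * ((C₁ + C₂) / l ^ 2) + 2 * (c⁻¹ * ((C₁ + C₂) / l)) ^ 2 := by gcongr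
      _ = _ := by ring
  · have hev : ∀ s ∈ Set.Ioo l (T - l), ‖x s‖⁻¹ • x s = -e := by
      intro s hs
      have : x s = -e := by
        simp only [hx, hy₁, hy₂]
        rw [boundaryLayer_of_le hl hs.1.le, boundaryLayer_of_le hl (by linarith [hs.2])]
        simp
      rw [this, norm_neg, he, inv_one, one_smul]
    have hloc : (fun t => ‖x t‖⁻¹ • x t) =ᶠ[nhds t] fun _ => -e :=
      Filter.eventually_of_mem (isOpen_Ioo.mem_nhds ht) hev
    refine ⟨?_, hev t ht⟩
    rw [covAccel, hloc.deriv.deriv_eq, hloc.deriv_eq]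
    simp
  · simp only
    rw [inner_smul_left, conj_trivial]
    have hpos : 0 < ‖x t‖ := norm_pos_iff.2 (hx0 t)
    rw [inv_mul_le_iff₀ hpos, mul_comm]
    rcases hside t with ⟨-, h⟩ | ⟨-, h⟩ <;> rw [h]
    · exact inner_boundaryLayer_sub_le he hp₀ hv₀ h₀ hκ hκ1 hκ2 hσ hl hlv₀ ht.1
    · exact inner_boundaryLayer_sub_le he hpT hvT' h_T hκ hκ1 hκ2 hσ hl hlvT
        (by linarith [ht.2])

/-- A curve on the sphere with small covariant acceleration which starts in a smaller cap spends
a definite amount of time in the larger one. -/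
theorem exists_pos_le_integral_cap {β : ℝ} (hβ : 0 < β) : ∃ c, 0 < c ∧ ∃ ε, 0 < ε ∧
    ∀ (y : ℝ → E) (e : E) (k : ℝ), ContDiff ℝ 2 y → (∀ s ∈ Set.Icc (0:ℝ) 1, ‖y s‖ = 1) →
      ‖e‖ = 1 → ∫ s in (0:ℝ)..1, ‖covAccel y s‖ ^ 2 ≤ ε ^ 2 → k + β ≤ ⟪y 0, e⟫ →
        c ≤ ∫ s in (0:ℝ)..1, max 0 (⟪y s, e⟫ - k) := by
  obtain ⟨c, hc, hcint⟩ := exists_pos_le_integral_comp_mul (P := 2 * Real.pi)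
    (g := fun φ => max 0 (β / 2 - √(2 - 2 * Real.cos φ))) (by positivity) (by fun_prop)
    (fun φ => by simp) (fun φ => le_max_left _ _) (by simp [hβ])
  refine ⟨c, hc, (β / 4) ^ 2, by positivity, fun y e k hy hunit he hint hk => ?_⟩
  refine (hcint ‖deriv y 0‖ (norm_nonneg _)).trans ?_
  have hcy := hy.continuous
  apply intervalIntegral.integral_mono_on zero_le_one
    (Continuous.intervalIntegrable (by fun_prop) _ _)
    (Continuous.intervalIntegrable (by fun_prop) _ _)
  intro s hs
  apply max_le_max le_rfl
  have h1 := norm_sub_le_of_integral_covAccel_sq_le hy hunit (by positivity) hint hs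
  rw [Real.sqrt_sq (by positivity)] at h1
  have h2 : ⟪y 0 - y s, e⟫ ≤ ‖y s - y 0‖ := by
    rw [norm_sub_rev]
    simpa [he] using real_inner_le_norm (y 0 - y s) e
  rw [inner_sub_left] at h2
  linarith

theorem covAccel_comp_add_mul {n : ℝ → E} (hn : ContDiff ℝ 2 n) (a κ s : ℝ) :
    covAccel (fun s => n (a + κ * s)) s = κ ^ 2 • covAccel n (a + κ * s) := by
  have haff : ∀ s, HasDerivAt (fun s => a + κ * s) κ s := fun s => by
    simpa using ((hasDerivAt_id s).const_mul κ).const_add a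
  have h1 : deriv (fun s => n (a + κ * s)) = fun s => κ • deriv n (a + κ * s) := funext fun s =>
    ((hn.hasDerivAt_deriv_two (a + κ * s)).1.scomp s (haff s)).deriv
  have h2 : deriv (fun s => κ • deriv n (a + κ * s)) s = κ • κ • deriv (deriv n) (a + κ * s) :=
    (((hn.hasDerivAt_deriv_two (a + κ * s)).2.1.scomp s (haff s)).const_smul κ).deriv
  rw [covAccel, h1, h2, covAccel, norm_smul, mul_pow, Real.norm_eq_abs, sq_abs]
  module

end SphereGeometry

theorem integral_comp_add_mul_le {f : ℝ → ℝ} (hf : Continuous f) (hnonneg : ∀ t, 0 ≤ f t)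
    {a κ T : ℝ} (hκ : κ ≠ 0) (ha : a ∈ Set.Icc 0 T) (haκ : a + κ ∈ Set.Icc 0 T) :
    ∫ s in (0:ℝ)..1, f (a + κ * s) ≤ |κ|⁻¹ * ∫ t in (0:ℝ)..T, f t := by
  rw [intervalIntegral.integral_comp_add_mul _ hκ, mul_zero, add_zero, mul_one, smul_eq_mul]
  have hint := hf.intervalIntegrable (μ := MeasureTheory.volume) 0 T
  have hnn := Filter.Eventually.of_forall (f := MeasureTheory.ae
    (MeasureTheory.volume.restrict (Set.Ioc 0 T))) hnonneg
  rcases lt_or_gt_of_ne hκ with h | h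
  · rw [abs_of_neg h, intervalIntegral.integral_symm, mul_neg, ← neg_mul, ← inv_neg]
    have : 0 < -κ := neg_pos.2 h
    gcongr
    exact intervalIntegral.integral_mono_interval haκ.1 (by linarith) ha.2 hnn hint
  · rw [abs_of_pos h]
    gcongr
    exact intervalIntegral.integral_mono_interval ha.1 (by linarith) haκ.2 hnn hint

section Potential

/-- The normalised obstacle potential as a function of the distance to the obstacle. -/
noncomputable def obstaclePotential (D : ℝ) (N : ℕ) (θ : ℝ) : ℝ := 1 / (1 + (θ / D) ^ (2 * N))

theorem one_add_pow_two_mul_pos (x : ℝ) (N : ℕ) : 0 < 1 + x ^ (2 * N) := by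
  rw [pow_mul]
  positivity

theorem obstaclePotential_nonneg (D : ℝ) (N : ℕ) (θ : ℝ) : 0 ≤ obstaclePotential D N θ :=
  div_nonneg zero_le_one (one_add_pow_two_mul_pos _ _).le

theorem obstaclePotential_le_one (D : ℝ) (N : ℕ) (θ : ℝ) : obstaclePotential D N θ ≤ 1 := by
  rw [obstaclePotential, div_le_one (one_add_pow_two_mul_pos _ _), pow_mul]
  linarith [pow_nonneg (sq_nonneg (θ / D)) N]

theorem obstaclePotential_anti {D : ℝ} (hD : 0 < D) (N : ℕ) {θ θ' : ℝ} (hθ : 0 ≤ θ)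
    (h : θ ≤ θ') : obstaclePotential D N θ' ≤ obstaclePotential D N θ := by
  unfold obstaclePotential
  gcongr

theorem obstaclePotential_self {D : ℝ} (hD : 0 < D) (N : ℕ) : obstaclePotential D N D = 1 / 2 := by
  rw [obstaclePotential, div_self hD.ne', one_pow]
  norm_num

theorem continuous_obstaclePotential (D : ℝ) (N : ℕ) : Continuous (obstaclePotential D N) := by
  unfold obstaclePotential
  exact continuous_const.div (by fun_prop) fun θ => (one_add_pow_two_mul_pos _ _).ne'

theorem exists_obstaclePotential_le {D θ δ : ℝ} (hD : 0 < D) (hθ : D < θ) (hδ : 0 < δ) :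
    ∃ N₀ : ℕ, ∀ N, N₀ ≤ N → obstaclePotential D N θ ≤ δ := by
  have hq : 1 < θ / D := (one_lt_div hD).2 hθ
  obtain ⟨N₀, hN₀⟩ := pow_unbounded_of_one_lt δ⁻¹ hq
  refine ⟨N₀, fun N hN => ?_⟩
  rw [obstaclePotential, one_div]
  refine inv_le_of_inv_le₀ hδ ?_
  have : (θ / D) ^ N₀ ≤ (θ / D) ^ (2 * N) := pow_le_pow_right₀ hq.le (by omega)
  linarith

/-- The potential dominates a multiple of the height over the plane bounding the obstacle cap. -/
theorem le_obstaclePotential_arccos {D : ℝ} (hD : 0 < D) (hDπ : D < Real.pi) {N : ℕ}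
    (hN : obstaclePotential D N Real.pi ≤ 1 / 4) {u : ℝ} (hu : u ≤ 1) :
    obstaclePotential D N Real.pi + 1 / 8 * max 0 (u - Real.cos D) ≤
      obstaclePotential D N (Real.arccos u) := by
  rcases le_or_gt u (Real.cos D) with h | h
  · rw [max_eq_left (by linarith), mul_zero, add_zero]
    exact obstaclePotential_anti hD N (Real.arccos_nonneg u) (Real.arccos_le_pi u)
  · rw [max_eq_right (by linarith)]
    have h1 : Real.arccos u ≤ D := by
      rw [← Real.arccos_cos hD.le hDπ.le]
      exact Real.arccos_le_arccos h.le
    have h2 := obstaclePotential_anti hD N (Real.arccos_nonneg u) h1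
    rw [obstaclePotential_self hD] at h2
    linarith [Real.neg_one_le_cos D]

end Potential

section Action

variable {T τ D : ℝ} {N : ℕ} {nstar : E3}

theorem actionJ_eq (T τ D : ℝ) (N : ℕ) (nstar : E3) (n : ℝ → E3) :
    actionJ T τ D N nstar n = ∫ t in (0:ℝ)..T,
      (1 / 2 * ‖covAccel n t‖ ^ 2 + τ * obstaclePotential D N (Real.arccos ⟪n t, nstar⟫)) := by
  simp only [actionJ, covAccel, obstaclePotential, sphereDist, mul_one_div]

theorem continuous_action_integrand {n : ℝ → E3} (hn : ContDiff ℝ 2 n) (τ D : ℝ) (N : ℕ)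
    (nstar : E3) : Continuous fun t =>
      1 / 2 * ‖covAccel n t‖ ^ 2 + τ * obstaclePotential D N (Real.arccos ⟪n t, nstar⟫) := by
  have h1 := hn.continuous_covAccel
  have h2 := hn.continuous
  have h3 := continuous_obstaclePotential D N
  have h4 := Real.continuous_arccos
  have h5 : Continuous fun t => obstaclePotential D N (Real.arccos ⟪n t, nstar⟫) :=
    h3.comp (h4.comp (by fun_prop))
  fun_prop

theorem le_actionJ (hT : 0 < T) (hτ : 0 ≤ τ) (hD : 0 < D) (hDπ : D < Real.pi)
    (hstar : ‖nstar‖ = 1) (hN : obstaclePotential D N Real.pi ≤ 1 / 4) {n : ℝ → E3}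
    (hn : ContDiff ℝ 2 n) (hunit : ∀ t ∈ Set.Icc 0 T, ‖n t‖ = 1) :
    τ * obstaclePotential D N Real.pi * T + 1 / 2 * (∫ t in (0:ℝ)..T, ‖covAccel n t‖ ^ 2)
      + τ / 8 * (∫ t in (0:ℝ)..T, max 0 (⟪n t, nstar⟫ - Real.cos D))
        ≤ actionJ T τ D N nstar n := by
  have h1 := hn.continuous_covAccel
  have h2 := hn.continuous
  have key : ∫ t in (0:ℝ)..T, (τ * obstaclePotential D N Real.pi + 1 / 2 * ‖covAccel n t‖ ^ 2
      + τ / 8 * max 0 (⟪n t, nstar⟫ - Real.cos D)) ≤ actionJ T τ D N nstar n := by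
    rw [actionJ_eq]
    apply intervalIntegral.integral_mono_on hT.le
      (Continuous.intervalIntegrable (by fun_prop) _ _)
      ((continuous_action_integrand hn _ _ _ _).intervalIntegrable _ _)
    intro t ht
    have h3 := real_inner_le_norm (n t) nstar
    rw [hunit t ht, hstar, one_mul] at h3
    nlinarith [le_obstaclePotential_arccos hD hDπ hN h3]
  rw [intervalIntegral.integral_add (Continuous.intervalIntegrable (by fun_prop) _ _)
    (Continuous.intervalIntegrable (by fun_prop) _ _),
    intervalIntegral.integral_add (Continuous.intervalIntegrable (by fun_prop) _ _)
    (Continuous.intervalIntegrable (by fun_prop) _ _), intervalIntegral.integral_const_mul,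
    intervalIntegral.integral_const_mul, intervalIntegral.integral_const_mul,
    intervalIntegral.integral_const, smul_eq_mul, sub_zero] at key
  linarith

theorem integral_le_mul_of_le_Ioo {f : ℝ → ℝ} (hf : Continuous f) {a b M : ℝ} (hab : a ≤ b)
    (h : ∀ t ∈ Set.Ioo a b, f t ≤ M) : ∫ t in a..b, f t ≤ M * (b - a) := by
  have := intervalIntegral.integral_mono_on_of_le_Ioo hab
    (hf.intervalIntegrable (μ := MeasureTheory.volume) a b) intervalIntegrable_const h
  rwa [intervalIntegral.integral_const, smul_eq_mul, mul_comm] at this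

theorem actionJ_le {σ l A u : ℝ} (hτ : 0 ≤ τ) (hD : 0 < D) (hstar : ‖nstar‖ = 1) (hσ : 0 < σ)
    (hσ1 : σ ≤ 1) (hl : 0 < l) (hlT : l ≤ T / 2) {m : ℝ → E3} (hm : ContDiff ℝ 2 m)
    (hacc : ∀ t ∈ Set.Icc 0 T, ‖covAccel m t‖ ≤ A)
    (hmid : ∀ t ∈ Set.Ioo l (T - l), covAccel m t = 0 ∧ m t = -nstar)
    (hout : ∀ t ∈ Set.Icc (σ * l) (T - σ * l), ⟪m t, nstar⟫ ≤ u) :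
    actionJ T τ D N nstar m ≤ τ * obstaclePotential D N Real.pi * T + A ^ 2 * l
      + τ * (2 * σ * l + 2 * l * obstaclePotential D N (Real.arccos u)) := by
  rw [actionJ_eq]
  have hcont := continuous_action_integrand hm τ D N nstar
  set f : ℝ → ℝ := fun t =>
    1 / 2 * ‖covAccel m t‖ ^ 2 + τ * obstaclePotential D N (Real.arccos ⟪m t, nstar⟫) with hf
  set V := obstaclePotential D N (Real.arccos u) with hV
  set Vπ := obstaclePotential D N Real.pi with hVπ
  have hσl : σ * l ≤ l := by nlinarith
  have hσl0 : 0 < σ * l := by positivity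
  have hV0 : 0 ≤ V := obstaclePotential_nonneg _ _ _
  have hVπ0 : 0 ≤ Vπ := obstaclePotential_nonneg _ _ _
  have hsq : ∀ t ∈ Set.Icc 0 T, ‖covAccel m t‖ ^ 2 ≤ A ^ 2 := fun t ht =>
    pow_le_pow_left₀ (norm_nonneg _) (hacc t ht) 2
  have hin : ∀ t ∈ Set.Icc 0 T, f t ≤ 1 / 2 * A ^ 2 + τ := fun t ht => by
    have := mul_le_mul_of_nonneg_left
      (obstaclePotential_le_one D N (Real.arccos ⟪m t, nstar⟫)) hτ
    simp only [hf]
    linarith [hsq t ht]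
  have hmed : ∀ t ∈ Set.Icc (σ * l) (T - σ * l), f t ≤ 1 / 2 * A ^ 2 + τ * V := fun t ht => by
    have := mul_le_mul_of_nonneg_left (obstaclePotential_anti hD N (Real.arccos_nonneg u)
      (Real.arccos_le_arccos (hout t ht))) hτ
    simp only [hf]
    linarith [hsq t ⟨by linarith [ht.1], by linarith [ht.2]⟩]
  have hfar : ∀ t ∈ Set.Ioo l (T - l), f t ≤ τ * Vπ := fun t ht => by
    obtain ⟨h1, h2⟩ := hmid t ht
    simp [hf, h1, h2, hstar, hVπ]
  have i1 := integral_le_mul_of_le_Ioo hcont (a := 0) (b := σ * l) hσl0.le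
    fun t ht => hin t ⟨ht.1.le, by linarith [ht.2]⟩
  have i2 := integral_le_mul_of_le_Ioo hcont hσl
    fun t ht => hmed t ⟨ht.1.le, by linarith [ht.2]⟩
  have i3 := integral_le_mul_of_le_Ioo hcont (by linarith) hfar
  have i4 := integral_le_mul_of_le_Ioo hcont (a := T - l) (b := T - σ * l) (by linarith)
    fun t ht => hmed t ⟨by linarith [ht.1], ht.2.le⟩
  have i5 := integral_le_mul_of_le_Ioo hcont (a := T - σ * l) (b := T) (by linarith)
    fun t ht => hin t ⟨by linarith [ht.1], ht.2.le⟩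
  have hii : ∀ a b, IntervalIntegrable f MeasureTheory.volume a b := hcont.intervalIntegrable
  have hsum := intervalIntegral.integral_add_adjacent_intervals
    (hii 0 (σ * l)) (hii (σ * l) T)
  rw [← intervalIntegral.integral_add_adjacent_intervals (hii (σ * l) l) (hii l T),
    ← intervalIntegral.integral_add_adjacent_intervals (hii l (T - l)) (hii (T - l) T),
    ← intervalIntegral.integral_add_adjacent_intervals (hii (T - l) (T - σ * l)) (hii _ T)] at hsum
  rw [← hsum]
  have e1 : 0 ≤ τ * Vπ * l := by positivity
  have e2 : 0 ≤ τ * V * (σ * l) := by positivity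
  nlinarith

end Action


/-- Proposition 10 (point obstacle): if the boundary-value problem is feasible
outside the geodesic `D`-ball around the undesired state `n⋆`, then for every
tolerance `r ∈ (0,D)` there exist `τ⋆ > 0` and `N⋆ ≥ 1` such that for all
`τ ≥ τ⋆` and `N ≥ N⋆` every minimiser of the action stays at geodesic distance
at least `r` from `n⋆`. -/
theorem point_obstacle_avoidance
    (T D : ℝ) (hT : 0 < T) (hD : 0 < D) (hDπ : D < Real.pi)
    (nstar : E3) (hstar : ‖nstar‖ = 1)
    (n₀ nT v₀ vT : E3) (hn₀ : ‖n₀‖ = 1) (hnT : ‖nT‖ = 1)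
    (hv₀ : ⟪n₀, v₀⟫ = 0) (hvT : ⟪nT, vT⟫ = 0)
    (hfeas : ∃ γ : ℝ → E3, Admissible T n₀ nT v₀ vT γ ∧
      ∀ t ∈ Set.Icc (0:ℝ) T, D ≤ sphereDist (γ t) nstar) :
    ∀ r, 0 < r → r < D →
      ∃ τstar : ℝ, 0 < τstar ∧ ∃ Nstar : ℕ, 1 ≤ Nstar ∧
        ∀ τ : ℝ, τstar ≤ τ → ∀ N : ℕ, Nstar ≤ N →
          ∀ n : ℝ → E3, Admissible T n₀ nT v₀ vT n →
            (∀ m : ℝ → E3, Admissible T n₀ nT v₀ vT m →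
              actionJ T τ D N nstar n ≤ actionJ T τ D N nstar m) →
            ∀ t ∈ Set.Icc (0:ℝ) T, r ≤ sphereDist (n t) nstar := by
  intro r hr hrD
  have hcosβ : 0 < Real.cos r - Real.cos D :=
    sub_pos.2 (Real.cos_lt_cos_of_nonneg_of_le_pi hr.le hDπ.le hrD)
  have hk1 : -1 < Real.cos D := by
    simpa using Real.cos_lt_cos_of_nonneg_of_le_pi hD.le le_rfl hDπ
  have hk2 : Real.cos D < 1 := by
    simpa using Real.cos_lt_cos_of_nonneg_of_le_pi le_rfl hDπ.le hD
  obtain ⟨γ, ⟨-, hγunit, hγ0, -, hγT, -⟩, hγ⟩ := hfeas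
  have hcap : ∀ t ∈ Set.Icc 0 T, ⟪γ t, nstar⟫ ≤ Real.cos D := fun t ht => by
    have h := abs_le.1 (abs_real_inner_le_norm (γ t) nstar)
    rw [hγunit t ht, hstar, one_mul] at h
    rw [← Real.cos_arccos h.1 h.2]
    exact Real.cos_le_cos_of_nonneg_of_le_pi hD.le (Real.arccos_le_pi _) (hγ t ht)
  have h₀ := hγ0 ▸ hcap 0 ⟨le_rfl, hT.le⟩
  have h_T := hγT ▸ hcap T ⟨hT.le, le_rfl⟩
  obtain ⟨c, hc, ε, hε, hcapint⟩ := exists_pos_le_integral_cap (E := E3) hcosβ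
  obtain ⟨C, hC, hcomp⟩ := exists_competitor hT hstar hn₀ hnT hv₀ hvT hk1 hk2 h₀ h_T
  obtain ⟨η, hη, hηε, hηc⟩ : ∃ η : ℝ, 0 < η ∧ 2 * η ≤ ε ^ 2 ∧ 8 * η < c :=
    ⟨min (ε ^ 2 / 2) (c / 16), by positivity, by linarith [min_le_left (ε ^ 2 / 2) (c / 16)],
      by linarith [min_le_right (ε ^ 2 / 2) (c / 16)]⟩
  obtain ⟨S, hS1, hSC⟩ : ∃ S : ℝ, 1 ≤ S ∧ C ^ 2 / S ^ 3 ≤ η / 3 := by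
    refine ⟨max 1 (3 * C ^ 2 / η), le_max_left _ _, ?_⟩
    set S := max 1 (3 * C ^ 2 / η)
    have h1 : 1 ≤ S := le_max_left _ _
    have h2 : 3 * C ^ 2 / η ≤ S := le_max_right _ _
    have h3 : S ≤ S ^ 3 := le_self_pow₀ h1 (by norm_num)
    rw [div_le_iff₀ hη] at h2
    rw [div_le_iff₀ (by positivity)]
    nlinarith
  have hS0 : 0 < S := by linarith
  obtain ⟨δ, hδ, hδ4, hδS⟩ : ∃ δ : ℝ, 0 < δ ∧ δ ≤ 1 / 4 ∧ δ * S ≤ η / 6 := by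
    refine ⟨min (1 / 4) (η / (6 * S)), by positivity, min_le_left _ _, ?_⟩
    calc min (1 / 4) (η / (6 * S)) * S ≤ η / (6 * S) * S := by
          gcongr
          exact min_le_right _ _
      _ = η / 6 := by field_simp
  obtain ⟨d, hd, hkd, l₀, hl₀, hl₀T, hcomp⟩ := hcomp δ hδ
  have hD₁ : D < Real.arccos (Real.cos D - d) := by
    nth_rw 1 [← Real.arccos_cos hD.le hDπ.le]
    exact Real.arccos_lt_arccos hkd.le (by linarith) (by linarith)
  obtain ⟨N₀, hN₀⟩ := exists_obstaclePotential_le hD hD₁ hδ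
  refine ⟨(S / l₀) ^ 4, by positivity, max 1 N₀, le_max_left _ _, fun τ hτ N hN n hn hmin => ?_⟩
  have hV := hN₀ N ((le_max_right _ _).trans hN)
  have hVπ : obstaclePotential D N Real.pi ≤ 1 / 4 :=
    ((obstaclePotential_anti hD N (Real.arccos_nonneg _) (Real.arccos_le_pi _)).trans hV).trans hδ4
  -- the natural time scale of the problem is `τ ^ (-1 / 4)`
  obtain ⟨μ, hμS, rfl⟩ : ∃ μ, S / l₀ ≤ μ ∧ μ ^ 4 = τ := by
    have hτ0 : 0 ≤ τ := le_trans (by positivity) hτ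
    have h4 : √√τ ^ 4 = τ := by
      rw [show 4 = 2 * 2 from rfl, pow_mul, Real.sq_sqrt (Real.sqrt_nonneg _), Real.sq_sqrt hτ0]
    exact ⟨√√τ, le_of_pow_le_pow_left₀ (n := 4) (by norm_num) (Real.sqrt_nonneg _)
      (h4.symm ▸ hτ), h4⟩
  have hμ : 0 < μ := lt_of_lt_of_le (by positivity) hμS
  have hl : S / μ ≤ l₀ := by
    rw [div_le_iff₀ hl₀] at hμS
    rw [div_le_iff₀ hμ]
    linarith
  have hμT : μ⁻¹ ≤ T / 2 := by
    refine le_trans ?_ (hl.trans hl₀T)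
    rw [inv_eq_one_div]
    gcongr
  obtain ⟨m, hm, hmunit, hmbdry, hmacc, hmmid, hmout⟩ := hcomp (S / μ) (by positivity) hl
  have hupper := actionJ_le (N := N) (τ := μ ^ 4) (by positivity) hD hstar hδ (by linarith)
    (by positivity) (hl.trans hl₀T) hm hmacc hmmid hmout
  have hlower := le_actionJ (N := N) (τ := μ ^ 4) hT (by positivity) hD hDπ hstar hVπ hn.1 hn.2.1
  have hle := hmin m ⟨hm, fun t _ => hmunit t, hmbdry⟩
  have hacc : (C / (S / μ) ^ 2) ^ 2 * (S / μ) ≤ η / 3 * μ ^ 3 := by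
    calc (C / (S / μ) ^ 2) ^ 2 * (S / μ) = C ^ 2 / S ^ 3 * μ ^ 3 := by field_simp
      _ ≤ _ := by gcongr
  have hpot : μ ^ 4 * (2 * δ * (S / μ) + 2 * (S / μ) *
      obstaclePotential D N (Real.arccos (Real.cos D - d))) ≤ 2 * η / 3 * μ ^ 3 := by
    calc _ ≤ μ ^ 4 * (2 * δ * (S / μ) + 2 * (S / μ) * δ) := by gcongr
      _ = 4 * (δ * S) * μ ^ 3 := by
          field_simp
          ring
      _ ≤ 4 * (η / 6) * μ ^ 3 := by gcongr
      _ = _ := by ring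
  set I := ∫ t in (0:ℝ)..T, ‖covAccel n t‖ ^ 2 with hI
  set P := ∫ t in (0:ℝ)..T, max 0 (⟪n t, nstar⟫ - Real.cos D) with hP
  have hI0 : 0 ≤ I := intervalIntegral.integral_nonneg hT.le fun t _ => by positivity
  have hP0 : 0 ≤ P := intervalIntegral.integral_nonneg hT.le fun t _ => le_max_left _ _
  have hμP0 : 0 ≤ μ ^ 4 * P := by positivity
  have hIle : I ≤ 2 * η * μ ^ 3 := by linarith
  have hPle : μ ^ 4 * P ≤ 8 * η * μ ^ 3 := by linarith
  intro t ht
  by_contra! hlt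
  have hcos : Real.cos D + (Real.cos r - Real.cos D) ≤ ⟪n t, nstar⟫ := by
    have h := abs_le.1 (abs_real_inner_le_norm (n t) nstar)
    rw [hn.2.1 t ht, hstar, one_mul] at h
    rw [← Real.cos_arccos h.1 h.2, add_sub_cancel]
    exact Real.cos_le_cos_of_nonneg_of_le_pi (Real.arccos_nonneg _) (by linarith) hlt.le
  obtain ⟨κ, hκ, htκ⟩ : ∃ κ, |κ| = μ⁻¹ ∧ t + κ ∈ Set.Icc 0 T := by
    have hμ' : 0 < μ⁻¹ := by positivity
    rcases le_total t (T / 2) with h | h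
    · exact ⟨μ⁻¹, abs_of_pos hμ', by linarith [ht.1], by linarith⟩
    · exact ⟨-μ⁻¹, by rw [abs_neg, abs_of_pos hμ'], by linarith, by linarith [ht.2]⟩
  have hκ0 : κ ≠ 0 := abs_pos.1 (hκ ▸ inv_pos.2 hμ)
  have hmem : ∀ s ∈ Set.Icc (0:ℝ) 1, t + κ * s ∈ Set.Icc 0 T := fun s hs => by
    have := (convex_Icc 0 T).add_smul_mem ht htκ hs
    rwa [smul_eq_mul, mul_comm] at this
  have hncont := hn.1.continuous
  have hacont := hn.1.continuous_covAccel
  have hIy : ∫ s in (0:ℝ)..1, ‖covAccel (fun s => n (t + κ * s)) s‖ ^ 2 ≤ ε ^ 2 := by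
    have hκ4 : ‖κ ^ 2‖ ^ 2 = (μ⁻¹) ^ 4 := by
      rw [norm_pow, Real.norm_eq_abs, hκ]
      ring
    simp only [covAccel_comp_add_mul hn.1, norm_smul, mul_pow, hκ4,
      intervalIntegral.integral_const_mul]
    calc μ⁻¹ ^ 4 * ∫ s in (0:ℝ)..1, ‖covAccel n (t + κ * s)‖ ^ 2 ≤ μ⁻¹ ^ 4 * (|κ|⁻¹ * I) := by
          gcongr
          exact integral_comp_add_mul_le (f := fun t => ‖covAccel n t‖ ^ 2) (by fun_prop)
            (fun t => by positivity) hκ0 ht htκ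
      _ ≤ μ⁻¹ ^ 4 * (μ * (2 * η * μ ^ 3)) := by
          rw [hκ, inv_inv]
          gcongr
      _ = 2 * η := by field_simp
      _ ≤ ε ^ 2 := hηε
  have hlow := hcapint (fun s => n (t + κ * s)) nstar (Real.cos D)
    (hn.1.comp (by fun_prop)) (fun s hs => hn.2.1 _ (hmem s hs)) hstar hIy (by simpa using hcos)
  have hPy := integral_comp_add_mul_le (f := fun t => max 0 (⟪n t, nstar⟫ - Real.cos D))
    (by fun_prop) (fun t => le_max_left _ _) hκ0 ht htκ
  rw [hκ, inv_inv, ← hP] at hPy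
  have hμP : μ * P ≤ 8 * η := by
    refine le_of_mul_le_mul_left ?_ (pow_pos hμ 3)
    linarith
  linarith
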